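/- For every natural number k ≥ 2, M > 0 and every tuple (a¹,…,a^{k²}) ∈ Δ^{k−1}_M × ⋯ × Δ^{k−1}_M (k² factors): the function H_{a¹,…,a^{k²}} can be represented by a ReLU DNN with k² hidden layers each of width k (depth k²+1, size k³), while every ReLU DNN with at most k hidden layers that represents H_{a¹,…,a^{k²}} has size at least (1/2)·k^{k+1} − 1. -/

import Mathlib

open scoped BigOperators

noncomputable section

/-- Coordinatewise ReLU activation. -/
def reluVec {n : ℕ} (x : Fin n → ℝ) : Fin n → ℝ := fun i => max (x i) 0

/-- `T` is an affine transformation. -/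
def IsAffineT {n m : ℕ} (T : (Fin n → ℝ) → (Fin m → ℝ)) : Prop :=
  ∃ (A : Matrix (Fin m) (Fin n) ℝ) (b : Fin m → ℝ), ∀ x, T x = A.mulVec x + b

/-- `T` is a linear transformation. -/
def IsLinearT {n m : ℕ} (T : (Fin n → ℝ) → (Fin m → ℝ)) : Prop :=
  ∃ A : Matrix (Fin m) (Fin n) ℝ, ∀ x, T x = A.mulVec x

/-- `RepresentsWith ws f` : the function `f : ℝ^n → ℝ^m` is computed by a ReLU DNN whose
hidden layers have widths given by the list `ws` (so the DNN has `ws.length` hidden layers,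
depth `ws.length + 1` and size `ws.sum`). -/
def RepresentsWithAux : List ℕ → (n m : ℕ) → ((Fin n → ℝ) → (Fin m → ℝ)) → Prop
  | [], _, _, f => IsLinearT f
  | w :: ws, n, m, f =>
      ∃ (T : (Fin n → ℝ) → (Fin w → ℝ)) (g : (Fin w → ℝ) → (Fin m → ℝ)),
        IsAffineT T ∧ RepresentsWithAux ws w m g ∧ ∀ x, f x = g (reluVec (T x))

/-- See `RepresentsWithAux`. -/
def RepresentsWith (ws : List ℕ) {n m : ℕ} (f : (Fin n → ℝ) → (Fin m → ℝ)) : Prop :=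
  RepresentsWithAux ws n m f

/-- Representability for real-valued functions on `ℝ^n`. -/
def RepresentsR (ws : List ℕ) {n : ℕ} (f : (Fin n → ℝ) → ℝ) : Prop :=
  RepresentsWith ws (fun x => fun _ : Fin 1 => f x)

/-- Representability for `ℝ → ℝ` functions. -/
def Represents1D (ws : List ℕ) (f : ℝ → ℝ) : Prop :=
  RepresentsWith ws (fun x : Fin 1 → ℝ => fun _ : Fin 1 => f (x 0))

/-- `f` agrees with an affine function on the set `S`. -/
def AffineOnSet {n : ℕ} (f : (Fin n → ℝ) → ℝ) (S : Set (Fin n → ℝ)) : Prop :=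
  ∃ (c : Fin n → ℝ) (d : ℝ), ∀ x ∈ S, f x = (∑ j, c j * x j) + d

/-- A polyhedron: the intersection of finitely many halfspaces. -/
def IsPolyhedron {n : ℕ} (P : Set (Fin n → ℝ)) : Prop :=
  ∃ (m : ℕ) (A : Fin m → Fin n → ℝ) (b : Fin m → ℝ),
    P = {x | ∀ i, (∑ j, A i j * x j) ≤ b i}

/-- Continuous piecewise linear function on `ℝ^n`: finitely many polyhedra covering `ℝ^n`,
with `f` affine on each. -/
def IsPWL {n : ℕ} (f : (Fin n → ℝ) → ℝ) : Prop :=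
  ∃ (N : ℕ) (P : Fin N → Set (Fin n → ℝ)),
    (∀ i, IsPolyhedron (P i)) ∧ (⋃ i, P i) = Set.univ ∧ ∀ i, AffineOnSet f (P i)

/-- `f : ℝ → ℝ` is piecewise linear with breakpoints `b 0 < b 1 < ⋯ < b (q-1)`, being affine
with slope `sl i` and intercept `ic i` on the `i`-th of the `q+1` closed pieces into which the
breakpoints partition `ℝ`. -/
def RealizesPieces (q : ℕ) (b : Fin q → ℝ) (sl ic : Fin (q+1) → ℝ) (f : ℝ → ℝ) : Prop :=
  StrictMono b ∧
  ∀ (i : Fin (q+1)) (x : ℝ),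
    (∀ j : Fin q, (j : ℕ) < (i : ℕ) → b j ≤ x) →
    (∀ j : Fin q, (i : ℕ) ≤ (j : ℕ) → x ≤ b j) →
    f x = sl i * x + ic i

/-- `f : ℝ → ℝ` is continuous piecewise linear with exactly `p` pieces: `ℝ` is partitioned into
`p` intervals on each of which `f` is affine, and consecutive pieces have different slopes. -/
def PWLPiecesExact (p : ℕ) (f : ℝ → ℝ) : Prop :=
  ∃ q : ℕ, p = q + 1 ∧ ∃ (b : Fin q → ℝ) (sl ic : Fin (q+1) → ℝ),
    RealizesPieces q b sl ic f ∧ ∀ i : Fin q, sl i.castSucc ≠ sl i.succ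

/-- `f : ℝ → ℝ` is continuous piecewise linear with at most `p` pieces. -/
def PWLPiecesAtMost (p : ℕ) (f : ℝ → ℝ) : Prop :=
  ∃ q : ℕ, q + 1 ≤ p ∧ ∃ (b : Fin q → ℝ) (sl ic : Fin (q+1) → ℝ),
    RealizesPieces q b sl ic f

/-- Membership in the simplex `Δ^p_M = {x : 0 < x 0 < x 1 < ⋯ < x (p-1) < M}`. -/
def InSimplex (M : ℝ) {p : ℕ} (a : Fin p → ℝ) : Prop :=
  StrictMono a ∧ (∀ i, 0 < a i) ∧ ∀ i, a i < M

/-- The knots `0, a 0, a 1, …, a (p-1), M` of the function `h_a`. -/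
def knot (M : ℝ) {p : ℕ} (a : Fin p → ℝ) (i : Fin (p+2)) : ℝ :=
  if _h0 : (i : ℕ) = 0 then 0
  else if _h1 : (i : ℕ) = p + 1 then M
  else a ⟨(i : ℕ) - 1, by have := i.isLt; omega⟩

/-- The prescribed value of `h_a` at the `i`-th knot: it alternates `0, M, 0, M, …`. -/
def knotVal (M : ℝ) (p : ℕ) (i : Fin (p+2)) : ℝ :=
  if (i : ℕ) % 2 = 1 then M else 0

/-- `h` is the function `h_a` associated with `a ∈ Δ^p_M`: it vanishes on `(-∞,0]`, is affine on
each interval between consecutive knots with the prescribed alternating values `0,M,0,M,…` at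
the knots, and for `x ≥ M` it linearly continues the piece on `[a (p-1), M]`. -/
def IsHa (M : ℝ) {p : ℕ} (a : Fin p → ℝ) (h : ℝ → ℝ) : Prop :=
  (∀ x : ℝ, x ≤ 0 → h x = 0) ∧
  (∀ i : Fin (p+1), ∀ t ∈ Set.Icc (0:ℝ) 1,
      h ((1 - t) * knot M a i.castSucc + t * knot M a i.succ)
        = (1 - t) * knotVal M p i.castSucc + t * knotVal M p i.succ) ∧
  (∀ x : ℝ, M ≤ x →
      h x = knotVal M p (Fin.last (p+1))
        + (x - M) * ((knotVal M p (Fin.last (p+1)) - knotVal M p ⟨p, by omega⟩)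
            / (M - knot M a ⟨p, by omega⟩)))

/-- The composition `h (k-1) ∘ ⋯ ∘ h 1 ∘ h 0` of a finite family of `ℝ → ℝ` functions. -/
def compFold {k : ℕ} (h : Fin k → ℝ → ℝ) : ℝ → ℝ :=
  fun x => (List.ofFn h).foldl (fun y g => g y) x

/-- `[0,M]` is partitioned into exactly `N` subintervals, on each of which `f` is affine
with minimum value `0` and maximum value `M`. -/
def PartitionAffineMinMax (f : ℝ → ℝ) (M : ℝ) (N : ℕ) : Prop :=
  ∃ c : Fin (N+1) → ℝ, StrictMono c ∧ c 0 = 0 ∧ c (Fin.last N) = M ∧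
    ∀ i : Fin N,
      (∃ s d : ℝ, ∀ x ∈ Set.Icc (c i.castSucc) (c i.succ), f x = s * x + d) ∧
      (∀ x ∈ Set.Icc (c i.castSucc) (c i.succ), 0 ≤ f x ∧ f x ≤ M) ∧
      (∃ x ∈ Set.Icc (c i.castSucc) (c i.succ), f x = 0) ∧
      (∃ x ∈ Set.Icc (c i.castSucc) (c i.succ), f x = M)

/-- `[0,M]` is partitioned into exactly `N` maximal subintervals of affinity of `f`:
`f` is affine on each subinterval and consecutive subintervals carry different slopes. -/
def PartitionAffineExact (f : ℝ → ℝ) (M : ℝ) (N : ℕ) : Prop :=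
  ∃ (c : Fin (N+1) → ℝ) (s d : Fin N → ℝ), StrictMono c ∧ c 0 = 0 ∧ c (Fin.last N) = M ∧
    (∀ i : Fin N, ∀ x ∈ Set.Icc (c i.castSucc) (c i.succ), f x = s i * x + d i) ∧
    ∀ i j : Fin N, (j : ℕ) = (i : ℕ) + 1 → s i ≠ s j

/-- The zonotope `Z(b 0, …, b (m-1)) = {λ₀ b⁰ + ⋯ + λ_{m-1} b^{m-1} : |λᵢ| ≤ 1}`. -/
def Zono {n m : ℕ} (b : Fin m → Fin n → ℝ) : Set (Fin n → ℝ) :=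
  {x | ∃ lam : Fin m → ℝ, (∀ i, |lam i| ≤ 1) ∧ x = ∑ i, lam i • b i}

/-- The set of maximal connected subsets of `ℝ^n` on which `f` is affine (the "pieces"). -/
def MaxAffinePieces {n : ℕ} (f : (Fin n → ℝ) → ℝ) : Set (Set (Fin n → ℝ)) :=
  {S | IsConnected S ∧ AffineOnSet f S ∧
    ∀ S', IsConnected S' → AffineOnSet f S' → S ⊆ S' → S' = S}

end

/-- The number of elements of `Z` strictly below a real number. -/
noncomputable def countBelow (Z : Finset ℝ) (x : ℝ) : ℕ := (Z.filter (· < x)).card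

theorem countBelow_mono (Z : Finset ℝ) : Monotone (countBelow Z) := fun _ _ hxy =>
  Finset.card_le_card (Finset.monotone_filter_right Z fun _ _ h => lt_of_lt_of_le h hxy)

theorem lt_iff_lt_of_countBelow_eq {Z : Finset ℝ} {x y : ℝ}
    (h : countBelow Z x = countBelow Z y) {z : ℝ} (hz : z ∈ Z) : z < x ↔ z < y := by
  wlog hxy : x ≤ y generalizing x y
  · exact (this h.symm (le_of_not_ge hxy)).symm
  have hsub : Z.filter (· < x) ⊆ Z.filter (· < y) :=
    Finset.monotone_filter_right Z fun _ _ h => lt_of_lt_of_le h hxy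
  have heq := Finset.eq_of_subset_of_card_le hsub h.ge
  have := congrArg (z ∈ ·) heq
  simpa [hz] using this

/-- The line splits into `N` (possibly empty) order-connected pieces, the fibres of a labelling,
on each of which the curve `u` is affine. -/
def PiecewiseAffineCurve (N : ℕ) {n : ℕ} (u : ℝ → Fin n → ℝ) : Prop :=
  ∃ (α : Type) (_ : Fintype α) (φ : ℝ → α) (A B : α → Fin n → ℝ),
    Fintype.card α = N ∧ (∀ l, (φ ⁻¹' {l}).OrdConnected) ∧
    ∀ x i, u x i = A (φ x) i * x + B (φ x) i

theorem PiecewiseAffineCurve.affine {N n m : ℕ} {u : ℝ → Fin n → ℝ}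
    (hu : PiecewiseAffineCurve N u) {T : (Fin n → ℝ) → (Fin m → ℝ)} (hT : IsAffineT T) :
    PiecewiseAffineCurve N (fun x => T (u x)) := by
  obtain ⟨α, hα, φ, A, B, hN, hφ, hu⟩ := hu
  obtain ⟨C, b, hT⟩ := hT
  refine ⟨α, hα, φ, fun l => C.mulVec (A l), fun l => C.mulVec (B l) + b, hN, hφ, fun x i => ?_⟩
  simp only [hT, Matrix.mulVec, dotProduct, Pi.add_apply, hu, Finset.sum_mul, mul_add,
    Finset.sum_add_distrib]
  simp only [mul_assoc, add_assoc]

theorem IsLinearT.isAffineT {n m : ℕ} {T : (Fin n → ℝ) → (Fin m → ℝ)} (hT : IsLinearT T) :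
    IsAffineT T := by
  obtain ⟨A, hA⟩ := hT
  exact ⟨A, 0, fun x => by simp [hA]⟩

theorem exists_affine_eq_relu {S : Set ℝ} {A B : ℝ}
    (hS : ∀ x ∈ S, ∀ y ∈ S, -B / A < x ↔ -B / A < y) :
    ∃ s t : ℝ, ∀ x ∈ S, max (A * x + B) 0 = s * x + t := by
  have key : (∀ x ∈ S, 0 ≤ A * x + B) ∨ (∀ x ∈ S, A * x + B ≤ 0) := by
    by_cases hA : A = 0
    · subst hA
      rcases le_total 0 B with h | h
      · exact Or.inl fun x _ => by simpa using h
      · exact Or.inr fun x _ => by simpa using h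
    have hz : ∀ x, A * x + B = A * (x - -B / A) := fun x => by field_simp; ring
    have side : (∀ x ∈ S, 0 ≤ x - -B / A) ∨ (∀ x ∈ S, x - -B / A ≤ 0) := by
      by_cases hx : ∃ x ∈ S, -B / A < x
      · obtain ⟨x, hx, hlt⟩ := hx
        exact Or.inl fun y hy => by linarith [(hS x hx y hy).1 hlt]
      · push Not at hx
        exact Or.inr fun y hy => by linarith [hx y hy]
    simp only [hz]
    rcases side with h | h <;> rcases le_total 0 A with h' | h'
    · exact Or.inl fun x hx => mul_nonneg h' (h x hx)
    · exact Or.inr fun x hx => mul_nonpos_of_nonpos_of_nonneg h' (h x hx)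
    · exact Or.inr fun x hx => mul_nonpos_of_nonneg_of_nonpos h' (h x hx)
    · exact Or.inl fun x hx => mul_nonneg_of_nonpos_of_nonpos h' (h x hx)
  rcases key with h | h
  · exact ⟨A, B, fun x hx => max_eq_left (h x hx)⟩
  · exact ⟨0, 0, fun x hx => by simpa using h x hx⟩

theorem PiecewiseAffineCurve.relu {N n : ℕ} {u : ℝ → Fin n → ℝ}
    (hu : PiecewiseAffineCurve N u) :
    PiecewiseAffineCurve (N * (n + 1)) (fun x => reluVec (u x)) := by
  obtain ⟨α, hα, φ, A, B, hN, hφ, hu⟩ := hu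
  let Z : α → Finset ℝ := fun l => Finset.univ.image fun i => -B l i / A l i
  have hZ : ∀ l x, countBelow (Z l) x < n + 1 := fun l x => Nat.lt_succ_of_le <|
    (Finset.card_filter_le _ _).trans <| Finset.card_image_le.trans (by simp)
  let ψ : ℝ → α × Fin (n + 1) := fun x => (φ x, ⟨countBelow (Z (φ x)) x, hZ _ _⟩)
  have hψ : ∀ x l m, ψ x = (l, m) ↔ φ x = l ∧ countBelow (Z l) x = m := by
    intro x l m
    simp only [ψ, Prod.mk.injEq, Fin.ext_iff]
    constructor <;> rintro ⟨rfl, h⟩ <;> exact ⟨rfl, h⟩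
  have hpiece : ∀ (l : α × Fin (n + 1)) (i : Fin n), ∃ s t : ℝ,
      ∀ x ∈ ψ ⁻¹' {l}, max (A l.1 i * x + B l.1 i) 0 = s * x + t := by
    rintro ⟨l, m⟩ i
    refine exists_affine_eq_relu fun x hx y hy => ?_
    have hx := (hψ _ _ _).1 hx
    have hy := (hψ _ _ _).1 hy
    exact lt_iff_lt_of_countBelow_eq (hx.2.trans hy.2.symm)
      (Finset.mem_image_of_mem _ (Finset.mem_univ i))
  choose s t hst using hpiece
  refine ⟨α × Fin (n + 1), inferInstance, ψ, s, t, by simp [hN], ?_, fun x i => ?_⟩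
  · rintro ⟨l, m⟩
    refine ⟨fun x hx y hy z hz => ?_⟩
    have hx := (hψ _ _ _).1 hx
    have hy := (hψ _ _ _).1 hy
    refine (hψ _ _ _).2 ⟨(hφ l).out hx.1 hy.1 hz, le_antisymm ?_ ?_⟩
    · exact (countBelow_mono _ hz.2).trans hy.2.le
    · exact hx.2.ge.trans (countBelow_mono _ hz.1)
  · rw [← hst (ψ x) i x rfl]
    simp only [reluVec, hu, ψ]

theorem RepresentsWithAux.piecewiseAffineCurve {ws : List ℕ} {n m : ℕ}
    {F : (Fin n → ℝ) → (Fin m → ℝ)} (hF : RepresentsWithAux ws n m F) {N : ℕ}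
    {u : ℝ → Fin n → ℝ} (hu : PiecewiseAffineCurve N u) :
    PiecewiseAffineCurve (N * (ws.map (· + 1)).prod) (fun x => F (u x)) := by
  induction ws generalizing n N u with
  | nil => simpa using hu.affine (IsLinearT.isAffineT hF)
  | cons w ws ih =>
    obtain ⟨T, g, hT, hg, hF⟩ := hF
    simp only [hF, List.map_cons, List.prod_cons, ← mul_assoc]
    exact ih hg (hu.affine hT).relu

/-- If a network computes `f`, and `f` takes the value `c` at the points of `S` but only finitely
often on `[0, M] ⊇ S`, then `S` has at most `∏ (wᵢ + 1)` points. -/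
theorem Represents1D.card_level_le {ws : List ℕ} {f : ℝ → ℝ} (hf : Represents1D ws f)
    {M c : ℝ} {S : Finset ℝ} (hS : ∀ x ∈ S, x ∈ Set.Icc 0 M ∧ f x = c)
    (hfin : {x ∈ Set.Icc 0 M | f x = c}.Finite) :
    S.card ≤ (ws.map (· + 1)).prod := by
  have hid : PiecewiseAffineCurve 1 (fun (x : ℝ) (_ : Fin 1) => x) :=
    ⟨Unit, inferInstance, fun _ => (), fun _ _ => 1, fun _ _ => 0, by simp,
      fun l => by simpa using Set.ordConnected_univ, fun x i => by simp⟩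
  obtain ⟨α, hα, φ, A, B, hN, hφ, hu⟩ := RepresentsWithAux.piecewiseAffineCurve hf hid
  rw [one_mul] at hN
  rw [← hN, ← Finset.card_univ]
  refine Finset.card_le_card_of_injOn φ (fun _ _ => Finset.mem_coe.2 (Finset.mem_univ _)) ?_
  have key : ∀ x ∈ S, ∀ y ∈ S, φ x = φ y → ¬ x < y := by
    intro x hx y hy hxy hlt
    refine (Set.Icc_infinite hlt) (hfin.subset fun z hz => ?_)
    have hzl : φ z = φ x := (hφ (φ x)).out rfl hxy.symm hz
    have h1 := hu x 0
    have h2 := hu y 0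
    have h3 := hu z 0
    rw [hzl] at h3
    rw [← hxy] at h2
    simp only [(hS x hx).2, (hS y hy).2] at h1 h2
    have hA : A (φ x) 0 = 0 := by
      have : A (φ x) 0 * (y - x) = 0 := by linarith
      exact (mul_eq_zero.1 this).resolve_right (sub_ne_zero.2 hlt.ne')
    refine ⟨⟨(hS x hx).1.1.trans hz.1, hz.2.trans (hS y hy).1.2⟩, ?_⟩
    rw [hA] at h1 h3
    linarith
  intro x hx y hy hxy
  exact le_antisymm (not_lt.1 (key y hy x hx hxy.symm)) (not_lt.1 (key x hx y hy hxy))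

/-- The data of `h_a` with knots indexed by `ℕ`: continuous zigzag through
`(K i, M * (i % 2))`, `i ≤ p + 1`, whose last piece extends to infinity. -/
structure IsZigzag (M : ℝ) (p : ℕ) (K : ℕ → ℝ) (h : ℝ → ℝ) : Prop where
  knot_zero : K 0 = 0
  knot_last : K (p + 1) = M
  knot_lt : ∀ i ≤ p, K i < K (i + 1)
  eq_zero : ∀ x ≤ 0, h x = 0
  eq_affine : ∀ i ≤ p, ∀ x, K i ≤ x → (x ≤ K (i + 1) ∨ i = p) →
    h x = M * (i % 2 : ℕ) +
      (x - K i) * ((M * ((i + 1) % 2 : ℕ) - M * (i % 2 : ℕ)) / (K (i + 1) - K i))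

theorem knotVal_eq (M : ℝ) (p : ℕ) (i : Fin (p + 2)) : knotVal M p i = M * ((i : ℕ) % 2 : ℕ) := by
  unfold knotVal
  rcases Nat.mod_two_eq_zero_or_one i with h | h <;> simp [h]

theorem knot_lt_knot {M : ℝ} (hM : 0 < M) {p : ℕ} {a : Fin p → ℝ} (ha : InSimplex M a)
    (i : Fin (p + 1)) : knot M a i.castSucc < knot M a i.succ := by
  obtain ⟨hmono, hpos, hlt⟩ := ha
  have hi := i.isLt
  unfold knot
  simp only [Fin.val_castSucc, Fin.val_succ]
  split_ifs
  all_goals first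
    | contradiction
    | omega
    | exact hM
    | exact hpos _
    | exact hlt _
    | exact hmono (Fin.mk_lt_mk.2 (by omega))

theorem IsHa.exists_isZigzag {M : ℝ} (hM : 0 < M) {p : ℕ} {a : Fin p → ℝ} (ha : InSimplex M a)
    {h : ℝ → ℝ} (hh : IsHa M a h) : ∃ K, IsZigzag M p K h := by
  obtain ⟨h0, hmid, hlast⟩ := hh
  let K : ℕ → ℝ := fun i => if hi : i < p + 2 then knot M a ⟨i, hi⟩ else 0
  have hK : ∀ i (hi : i < p + 2), K i = knot M a ⟨i, hi⟩ := fun i hi => dif_pos hi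
  have hKM : K (p + 1) = M := by simp [hK (p + 1) (by omega), knot]
  have hKlt : ∀ i ≤ p, K i < K (i + 1) := fun i hi => by
    rw [hK i (by omega), hK (i + 1) (by omega)]
    exact knot_lt_knot hM ha ⟨i, by omega⟩
  refine ⟨K, by simp [hK 0 (by omega), knot], hKM, hKlt, h0, fun i hi x hx hx' => ?_⟩
  have hlt := hKlt i hi
  have hne : K (i + 1) - K i ≠ 0 := by linarith
  by_cases hxi : x ≤ K (i + 1)
  · have hm := hmid ⟨i, by omega⟩ ((x - K i) / (K (i + 1) - K i))
      ⟨div_nonneg (by linarith) (by linarith), (div_le_one (by linarith)).2 (by linarith)⟩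
    simp only [knotVal_eq, Fin.castSucc_mk, Fin.succ_mk, ← hK] at hm
    have hxe : (1 - (x - K i) / (K (i + 1) - K i)) * K i
        + (x - K i) / (K (i + 1) - K i) * K (i + 1) = x := by
      field_simp; ring
    rw [hxe] at hm
    rw [hm]
    ring
  · obtain rfl : i = p := hx'.resolve_left hxi
    have hl := hlast x (by linarith)
    simp only [knotVal_eq, ← hK, Fin.val_last] at hl
    rw [hl, ← hKM]
    field_simp
    ring

namespace IsZigzag

variable {M : ℝ} {p : ℕ} {K : ℕ → ℝ} {h : ℝ → ℝ}

theorem knot_le (H : IsZigzag M p K h) {i j : ℕ} (hij : i ≤ j) (hj : j ≤ p + 1) :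
    K i ≤ K j := by
  induction j, hij using Nat.le_induction with
  | base => exact le_rfl
  | succ j hij ih => exact (ih (by omega)).trans (H.knot_lt j (by omega)).le

theorem exists_piece (H : IsZigzag M p K h) {x : ℝ} (hx : 0 ≤ x) :
    ∃ i ≤ p, K i ≤ x ∧ (x ≤ K (i + 1) ∨ i = p) := by
  have key : ∀ n ≤ p, ∃ i ≤ n, K i ≤ x ∧ (x ≤ K (i + 1) ∨ i = n) := by
    intro n
    induction n with
    | zero => exact fun _ => ⟨0, le_rfl, by rwa [H.knot_zero], Or.inr rfl⟩
    | succ n ih =>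
      intro hn
      obtain ⟨i, hi, hix, hxi⟩ := ih (by omega)
      by_cases hlt : x ≤ K (i + 1)
      · exact ⟨i, by omega, hix, Or.inl hlt⟩
      · obtain rfl := hxi.resolve_left hlt
        exact ⟨i + 1, le_rfl, (not_le.1 hlt).le, Or.inr rfl⟩
  exact key p le_rfl

theorem exists_piece_Icc (H : IsZigzag M p K h) {x : ℝ} (hx : x ∈ Set.Icc 0 M) :
    ∃ i ≤ p, K i ≤ x ∧ x ≤ K (i + 1) := by
  obtain ⟨i, hi, hix, hxi⟩ := H.exists_piece hx.1
  refine ⟨i, hi, hix, hxi.elim id ?_⟩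
  rintro rfl
  rw [H.knot_last]
  exact hx.2

/-- On each piece, `h` is the affine bijection onto `[0, M]`, increasing or decreasing. -/
theorem eq_or (H : IsZigzag M p K h) {i : ℕ} (hi : i ≤ p) :
    (∀ x, K i ≤ x → x ≤ K (i + 1) → h x = M * ((x - K i) / (K (i + 1) - K i))) ∨
    (∀ x, K i ≤ x → x ≤ K (i + 1) → h x = M * ((K (i + 1) - x) / (K (i + 1) - K i))) := by
  have hne : K (i + 1) - K i ≠ 0 := by linarith [H.knot_lt i hi]
  rcases Nat.mod_two_eq_zero_or_one i with h0 | h1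
  · have : (i + 1) % 2 = 1 := by omega
    refine Or.inl fun x hx hx' => ?_
    rw [H.eq_affine i hi x hx (Or.inl hx'), h0, this]
    push_cast
    ring
  · have : (i + 1) % 2 = 0 := by omega
    refine Or.inr fun x hx hx' => ?_
    rw [H.eq_affine i hi x hx (Or.inl hx'), h1, this]
    push_cast
    field_simp
    ring

theorem exists_preimage (H : IsZigzag M p K h) (hM : 0 < M) {y : ℝ} (hy : y ∈ Set.Ioo 0 M)
    {i : ℕ} (hi : i ≤ p) : ∃ x ∈ Set.Ioo (K i) (K (i + 1)), h x = y := by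
  have hlt : 0 < K (i + 1) - K i := by linarith [H.knot_lt i hi]
  have hpos : 0 < y / M := div_pos hy.1 hM
  have hone : y / M < 1 := (div_lt_one hM).2 hy.2
  have h1 : 0 < y / M * (K (i + 1) - K i) := mul_pos hpos hlt
  have h2 : y / M * (K (i + 1) - K i) < K (i + 1) - K i := mul_lt_of_lt_one_left hlt hone
  rcases H.eq_or hi with hx | hx
  · refine ⟨K i + y / M * (K (i + 1) - K i), ⟨by linarith, by linarith⟩, ?_⟩
    rw [hx _ (by linarith) (by linarith)]
    field_simp
    ring
  · refine ⟨K (i + 1) - y / M * (K (i + 1) - K i), ⟨by linarith, by linarith⟩, ?_⟩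
    rw [hx _ (by linarith) (by linarith)]
    field_simp
    ring

theorem mapsTo (H : IsZigzag M p K h) (hM : 0 < M) :
    Set.MapsTo h (Set.Icc 0 M) (Set.Icc 0 M) := by
  intro x hx
  obtain ⟨i, hi, hix, hxi⟩ := H.exists_piece_Icc hx
  have hlt : 0 < K (i + 1) - K i := by linarith [H.knot_lt i hi]
  rcases H.eq_or hi with he | he <;> rw [he x hix hxi]
  · exact ⟨mul_nonneg hM.le (div_nonneg (by linarith) hlt.le),
      mul_le_of_le_one_right hM.le ((div_le_one hlt).2 (by linarith))⟩
  · exact ⟨mul_nonneg hM.le (div_nonneg (by linarith) hlt.le),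
      mul_le_of_le_one_right hM.le ((div_le_one hlt).2 (by linarith))⟩

theorem finite_level (H : IsZigzag M p K h) (hM : 0 < M) (y : ℝ) :
    {x ∈ Set.Icc 0 M | h x = y}.Finite := by
  have hsub : {x ∈ Set.Icc 0 M | h x = y} ⊆
      ⋃ i ∈ Finset.range (p + 1), {x ∈ Set.Icc (K i) (K (i + 1)) | h x = y} := by
    rintro x ⟨hx, hxy⟩
    obtain ⟨i, hi, hix, hxi⟩ := H.exists_piece_Icc hx
    exact Set.mem_biUnion (Finset.mem_coe.2 (Finset.mem_range.2 (by omega))) ⟨⟨hix, hxi⟩, hxy⟩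
  refine (Set.Finite.biUnion (Finset.finite_toSet _) fun i hi => ?_).subset hsub
  have hi : i ≤ p := by simpa [Nat.lt_succ_iff] using hi
  have hne : K (i + 1) - K i ≠ 0 := by linarith [H.knot_lt i hi]
  refine Set.Subsingleton.finite ?_
  rintro x ⟨⟨hx1, hx2⟩, hxy⟩ x' ⟨⟨hx1', hx2'⟩, hxy'⟩
  rcases H.eq_or hi with he | he
  all_goals
    rw [he x hx1 hx2] at hxy
    rw [he x' hx1' hx2', ← hxy] at hxy'
    have := mul_left_cancel₀ hM.ne' hxy'
    rw [div_left_inj' hne] at this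
    linarith

theorem exists_preimage_finset (H : IsZigzag M p K h) (hM : 0 < M) (S : Finset ℝ)
    (hS : ∀ y ∈ S, y ∈ Set.Ioo 0 M) :
    ∃ S' : Finset ℝ, S'.card = S.card * (p + 1) ∧ ∀ x ∈ S', x ∈ Set.Ioo 0 M ∧ h x ∈ S := by
  have hpre : ∀ q : S × Fin (p + 1), ∃ x ∈ Set.Ioo (K q.2) (K (q.2 + 1)), h x = q.1 :=
    fun q => H.exists_preimage hM (hS _ q.1.2) (Nat.lt_succ_iff.1 q.2.2)
  choose f hf hfy using hpre
  have hinj : Function.Injective f := by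
    have key : ∀ q q', f q = f q' → ¬ q.2 < q'.2 := by
      intro q q' hqq hlt
      have h1 := (hf q).2
      have h2 := (hf q').1
      have h3 : K (q.2 + 1) ≤ K q'.2 := H.knot_le (by exact hlt) (by omega)
      linarith
    intro q q' hqq
    refine Prod.ext (Subtype.ext ?_)
      (le_antisymm (not_lt.1 (key _ _ hqq.symm)) (not_lt.1 (key _ _ hqq)))
    rw [← hfy q, ← hfy q', hqq]
  refine ⟨Finset.univ.map ⟨f, hinj⟩, by simp, fun x hx => ?_⟩
  obtain ⟨q, -, rfl⟩ := Finset.mem_map.1 hx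
  refine ⟨⟨lt_of_le_of_lt ?_ (hf q).1, lt_of_lt_of_le (hf q).2 ?_⟩, ?_⟩
  · rw [← H.knot_zero]
    exact H.knot_le (Nat.zero_le _) (by omega)
  · rw [← H.knot_last]
    exact H.knot_le (by omega) le_rfl
  · rw [Function.Embedding.coeFn_mk, hfy q]
    exact q.1.2

theorem exists_eq_sum_relu (H : IsZigzag M p K h) :
    ∃ C b : Fin (p + 1) → ℝ, ∀ x, h x = ∑ i, C i * max (x - b i) 0 := by
  let V : ℕ → ℝ := fun i => M * (i % 2 : ℕ)
  let s : ℕ → ℝ := fun i => (V (i + 1) - V i) / (K (i + 1) - K i)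
  let C : ℕ → ℝ := fun i => s i - if i = 0 then 0 else s (i - 1)
  have hsum : ∀ m ≤ p, ∀ x,
      ∑ i ∈ Finset.range (m + 1), C i * (x - K i) = V m + (x - K m) * s m := by
    intro m
    induction m with
    | zero => intro _ x; simp [C, V]; ring
    | succ m ih =>
      intro hm x
      have hne : K (m + 1) - K m ≠ 0 := by linarith [H.knot_lt m (by omega)]
      have hs : s m * (K (m + 1) - K m) = V (m + 1) - V m := div_mul_cancel₀ _ hne
      rw [Finset.sum_range_succ, ih (by omega)]
      simp only [C, Nat.succ_ne_zero, if_false, Nat.add_sub_cancel]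
      linarith
  refine ⟨fun i => C i, fun i => K i, fun x => ?_⟩
  rw [Fin.sum_univ_eq_sum_range (fun i => C i * max (x - K i) 0)]
  rcases le_total x 0 with hx | hx
  · rw [H.eq_zero x hx, Finset.sum_eq_zero]
    intro i hi
    have hi := Finset.mem_range.1 hi
    have : K 0 ≤ K i := H.knot_le (Nat.zero_le _) (by omega)
    rw [H.knot_zero] at this
    rw [max_eq_right (by linarith), mul_zero]
  · obtain ⟨m, hm, hmx, hxm⟩ := H.exists_piece hx
    rw [H.eq_affine m hm x hmx hxm, ← Finset.sum_range_add_sum_Ico _ (Nat.succ_le_succ hm),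
      Finset.sum_eq_zero (s := Finset.Ico _ _), add_zero]
    · refine (hsum m hm x).symm.trans (Finset.sum_congr rfl fun i hi => ?_)
      have hi := Finset.mem_range.1 hi
      have : K i ≤ K m := H.knot_le (by omega) (by omega)
      rw [max_eq_left (by linarith)]
    · intro i hi
      have hi := Finset.mem_Ico.1 hi
      rcases hxm with hxm | rfl
      · have : K (m + 1) ≤ K i := H.knot_le hi.1 (by omega)
        rw [max_eq_right (by linarith), mul_zero]
      · omega

end IsZigzag

/-- Composing functions that are each a combination of `k` ReLUs gives a network with one
layer of width `k` per function. -/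
theorem representsWithAux_foldl {k : ℕ} (L : List (ℝ → ℝ))
    (hL : ∀ h ∈ L, ∃ C b : Fin k → ℝ, ∀ x, h x = ∑ i, C i * max (x - b i) 0)
    {n : ℕ} (c : Fin n → ℝ) :
    RepresentsWithAux (List.replicate L.length k) n 1
      (fun x _ => L.foldl (fun y g => g y) (∑ j, c j * x j)) := by
  induction L generalizing n with
  | nil => exact ⟨fun _ => c, fun x => by ext i; simp [Matrix.mulVec, dotProduct]⟩
  | cons h L ih =>
    obtain ⟨C, b, hC⟩ := hL h (by simp)
    refine ⟨fun x i => ∑ j, c j * x j - b i, _, ⟨fun _ => c, fun i => -b i, fun x => ?_⟩,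
      ih (fun g hg => hL g (by simp [hg])) C, fun x => ?_⟩
    · ext i
      simp [Matrix.mulVec, dotProduct, sub_eq_add_neg]
    · simp only [List.foldl_cons, hC, reluVec]

section Composition

variable {M : ℝ} {p : ℕ} {L : List (ℝ → ℝ)}

theorem finite_level_foldl (hM : 0 < M) (hL : ∀ h ∈ L, ∃ K, IsZigzag M p K h) (y : ℝ) :
    {x ∈ Set.Icc 0 M | L.foldl (fun y g => g y) x = y}.Finite := by
  induction L with
  | nil => exact (Set.finite_singleton y).subset fun x hx => hx.2
  | cons h L ih =>
    obtain ⟨K, H⟩ := hL h (by simp)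
    have hfin := ih fun g hg => hL g (by simp [hg])
    refine (hfin.biUnion fun z _ => H.finite_level hM z).subset ?_
    rintro x ⟨hx, hxy⟩
    exact Set.mem_biUnion (x := h x) ⟨H.mapsTo hM hx, hxy⟩ ⟨hx, rfl⟩

theorem exists_finset_level_foldl (hM : 0 < M) (hL : ∀ h ∈ L, ∃ K, IsZigzag M p K h) {y : ℝ}
    (hy : y ∈ Set.Ioo 0 M) :
    ∃ S : Finset ℝ, S.card = (p + 1) ^ L.length ∧
      ∀ x ∈ S, x ∈ Set.Ioo 0 M ∧ L.foldl (fun y g => g y) x = y := by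
  induction L with
  | nil => exact ⟨{y}, by simp, by simpa using hy⟩
  | cons h L ih =>
    obtain ⟨K, H⟩ := hL h (by simp)
    obtain ⟨S, hcard, hS⟩ := ih fun g hg => hL g (by simp [hg])
    obtain ⟨S', hcard', hS'⟩ := H.exists_preimage_finset hM S fun z hz => (hS z hz).1
    exact ⟨S', by rw [hcard', hcard, List.length_cons, pow_succ],
      fun x hx => ⟨(hS' x hx).1, (hS _ (hS' x hx).2).2⟩⟩

end Composition

/-- A form of the AM-GM inequality for the numbers `wᵢ + 1`. -/
theorem prod_map_succ_le {c : ℝ} (hc : 0 < c) (ws : List ℕ) :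
    (((ws.map (· + 1)).prod : ℕ) : ℝ) ≤
      c ^ ws.length * Real.exp ((ws.sum + ws.length) / c - ws.length) := by
  induction ws with
  | nil => simp
  | cons w ws ih =>
    have hw : ((w : ℝ) + 1) ≤ c * Real.exp ((w + 1) / c - 1) := by
      have := Real.add_one_le_exp (((w : ℝ) + 1) / c - 1)
      calc ((w : ℝ) + 1) = c * (((w : ℝ) + 1) / c - 1 + 1) := by field_simp; ring
        _ ≤ _ := mul_le_mul_of_nonneg_left this hc.le
    calc ((((w :: ws).map (· + 1)).prod : ℕ) : ℝ)
        = ((w : ℝ) + 1) * ((ws.map (· + 1)).prod : ℕ) := by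
          simp
      _ ≤ (c * Real.exp ((w + 1) / c - 1)) *
          (c ^ ws.length * Real.exp ((ws.sum + ws.length) / c - ws.length)) :=
        mul_le_mul hw ih (by positivity) (by positivity)
      _ = _ := by
        rw [mul_mul_mul_comm, ← Real.exp_add, List.length_cons, pow_succ']
        congr 2
        simp only [List.sum_cons]
        push_cast
        ring

theorem mul_le_sum_add_of_pow_le_prod {c : ℝ} (hc : 0 < c) {k : ℕ} {ws : List ℕ}
    (hlen : ws.length ≤ k) (hprod : c ^ k ≤ ((ws.map (· + 1)).prod : ℕ)) :
    k * c ≤ ws.sum + k := by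
  have hpad := prod_map_succ_le hc (ws ++ List.replicate (k - ws.length) 0)
  have hl : (ws ++ List.replicate (k - ws.length) 0).length = k := by simp; omega
  rw [hl] at hpad
  simp only [List.map_append, List.map_replicate, List.prod_append, List.prod_replicate,
    List.sum_append, List.sum_replicate, zero_add, one_pow, mul_one, smul_zero, add_zero] at hpad
  have h1 : c ^ k * 1 ≤ c ^ k * Real.exp ((ws.sum + k) / c - k) := by
    rw [mul_one]; exact hprod.trans hpad
  have h2 := Real.one_le_exp_iff.1 (le_of_mul_le_mul_left h1 (pow_pos hc k))
  have h3 : (k : ℝ) ≤ (ws.sum + k) / c := by linarith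
  exact (le_div_iff₀ hc).1 h3

/-- For `k ≥ 2` and `(a¹,…,a^{k²}) ∈ (Δ^{k-1}_M)^{k²}`, the function
`H_{a¹,…,a^{k²}}` is representable by a ReLU DNN with `k²` hidden layers each of width `k`
(size `k³`), while every ReLU DNN with at most `k` hidden layers representing it has size
at least `(1/2)·k^{k+1} − 1`. -/
theorem stmt9 (k : ℕ) (hk : 2 ≤ k) (M : ℝ) (hM : 0 < M)
    (a : Fin (k^2) → Fin (k-1) → ℝ) (ha : ∀ i, InSimplex M (a i))
    (h : Fin (k^2) → ℝ → ℝ) (hh : ∀ i, IsHa M (a i) (h i)) :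
    Represents1D (List.replicate (k^2) k) (compFold h) ∧
    ∀ ws : List ℕ, ws.length ≤ k → Represents1D ws (compFold h) →
      (1/2 : ℝ) * (k : ℝ) ^ (k + 1) - 1 ≤ (ws.sum : ℝ) := by
  obtain ⟨p, rfl⟩ : ∃ p, k = p + 1 := ⟨k - 1, by omega⟩
  have hL : ∀ g ∈ List.ofFn h, ∃ K, IsZigzag M p K g := by
    intro g hg
    obtain ⟨i, rfl⟩ := List.mem_ofFn.1 hg
    exact (hh i).exists_isZigzag hM (ha i)
  refine ⟨?_, fun ws hlen hws => ?_⟩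
  · have hrep := representsWithAux_foldl (List.ofFn h)
      (fun g hg => (hL g hg).elim fun K H => H.exists_eq_sum_relu) (fun _ : Fin 1 => 1)
    simp only [List.length_ofFn, Fin.sum_univ_one, one_mul] at hrep
    exact hrep
  · obtain ⟨S, hcard, hS⟩ := exists_finset_level_foldl hM hL (y := M / 2)
      ⟨by linarith, by linarith⟩
    have hle := hws.card_level_le
      (fun x hx => ⟨Set.Ioo_subset_Icc_self (hS x hx).1, (hS x hx).2⟩)
      (finite_level_foldl hM hL (M / 2))
    rw [hcard, List.length_ofFn, sq, pow_mul] at hle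
    have hle' : (((p + 1 : ℕ) : ℝ) ^ (p + 1)) ^ (p + 1) ≤ ((ws.map (· + 1)).prod : ℕ) := by
      exact_mod_cast hle
    have hsum := mul_le_sum_add_of_pow_le_prod (by positivity) hlen hle'
    have hk' : (2 : ℝ) ≤ ((p + 1 : ℕ) : ℝ) := by exact_mod_cast hk
    have hpow : (2 : ℝ) ≤ ((p + 1 : ℕ) : ℝ) ^ (p + 1) :=
      hk'.trans (le_self_pow₀ (by linarith) (by omega))
    rw [pow_succ']
    nlinarith
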